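/- The surfaces sin θᵢ = 0 are invariant under the flow of X: if f : ℝ → ℝ³ is a differentiable function satisfying f′(t) = X(f(t)) for all t ∈ ℝ, and if for some i ∈ {1, 2, 3} the i-th component of f(0) satisfies sin((f(0))ᵢ) = 0, then sin((f(t))ᵢ) = 0 for all t ∈ ℝ. In particular, for every integer k the planes θᵢ = kπ are invariant under the flow of X. -/

import Mathlib

open Real

/-- A solution of the scalar linear equation `s' = a s` with continuous coefficient that vanishes
at `0` vanishes identically. -/
theorem eq_zero_of_hasDerivAt_mul_self {a s : ℝ → ℝ} (ha : Continuous a)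
    (hs : ∀ t, HasDerivAt s (a t * s t) t) (h0 : s 0 = 0) (t : ℝ) : s t = 0 := by
  have hA : ∀ t, HasDerivAt (fun t => ∫ r in (0 : ℝ)..t, a r) (a t) t := fun t =>
    ha.integral_hasStrictDerivAt 0 t |>.hasDerivAt
  have hg : ∀ t, HasDerivAt (fun t => s t * exp (-∫ r in (0 : ℝ)..t, a r)) 0 t := fun t =>
    ((hs t).mul (hA t).neg.exp).congr_deriv (by ring)
  have h := is_const_of_deriv_eq_zero (fun t => (hg t).differentiableAt)
    (fun t => (hg t).deriv) t 0
  simpa [h0, exp_ne_zero] using h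

/-- If `x' = b sin x + c sin 2x` with continuous coefficients and `sin (x 0) = 0`, then `sin x`
vanishes identically. -/
theorem sin_eq_zero_of_hasDerivAt {b c x : ℝ → ℝ} (hb : Continuous b) (hc : Continuous c)
    (hx : ∀ t, HasDerivAt x (b t * sin (x t) + c t * sin (2 * x t)) t)
    (h0 : sin (x 0) = 0) (t : ℝ) : sin (x t) = 0 := by
  have hxc : Continuous x := continuous_iff_continuousAt.2 fun t => (hx t).continuousAt
  refine eq_zero_of_hasDerivAt_mul_self (s := fun t => sin (x t))
    (a := fun t => cos (x t) * (b t + 2 * c t * cos (x t))) (by fun_prop)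
    (fun t => (hx t).sin.congr_deriv ?_) h0 t
  rw [sin_two_mul]
  ring

/-- The surfaces `sin θᵢ = 0` are invariant under the flow of the vector field
`X` of system (11): along any solution `f` of `f' = X ∘ f`, if the `i`-th
component satisfies `sin ((f 0)ᵢ) = 0` then `sin ((f t)ᵢ) = 0` for all `t`. In
particular the planes `θᵢ = kπ` are invariant under the flow of `X`. -/
theorem sin_planes_flow_invariant
    (u ε q : ℝ) (X : ℝ × ℝ × ℝ → ℝ × ℝ × ℝ)
    (hX : ∀ θ : ℝ × ℝ × ℝ, X θ =
      (u * sin θ.1 * cos θ.2.1 + ε * sin (2 * θ.1) * cos (2 * θ.2.1),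
       u * sin θ.2.1 * cos θ.2.2 + ε * sin (2 * θ.2.1) * cos (2 * θ.2.2),
       u * sin θ.2.2 * cos θ.1 + ε * sin (2 * θ.2.2) * cos (2 * θ.1)
         + q * (1 - cos θ.1) * sin (2 * θ.2.2)))
    (f : ℝ → ℝ × ℝ × ℝ)
    (hf : ∀ t : ℝ, HasDerivAt f (X (f t)) t) :
    (sin (f 0).1 = 0 → ∀ t : ℝ, sin (f t).1 = 0) ∧
    (sin (f 0).2.1 = 0 → ∀ t : ℝ, sin (f t).2.1 = 0) ∧
    (sin (f 0).2.2 = 0 → ∀ t : ℝ, sin (f t).2.2 = 0) := by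
  have hfc : Continuous f := continuous_iff_continuousAt.2 fun t => (hf t).continuousAt
  have h₁ : ∀ t, HasDerivAt (fun t => (f t).1) (X (f t)).1 t := fun t =>
    (hf t).hasFDerivAt.fst.hasDerivAt.congr_deriv (by simp)
  have h₂ : ∀ t, HasDerivAt (fun t => (f t).2.1) (X (f t)).2.1 t := fun t =>
    (hf t).hasFDerivAt.snd.fst.hasDerivAt.congr_deriv (by simp)
  have h₃ : ∀ t, HasDerivAt (fun t => (f t).2.2) (X (f t)).2.2 t := fun t =>
    (hf t).hasFDerivAt.snd.snd.hasDerivAt.congr_deriv (by simp)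
  simp only [hX] at h₁ h₂ h₃
  refine ⟨fun h => ?_, fun h => ?_, fun h => ?_⟩
  · exact sin_eq_zero_of_hasDerivAt (x := fun t => (f t).1) (b := fun t => u * cos (f t).2.1)
      (c := fun t => ε * cos (2 * (f t).2.1)) (by fun_prop) (by fun_prop)
      (fun t => (h₁ t).congr_deriv (by ring)) h
  · exact sin_eq_zero_of_hasDerivAt (x := fun t => (f t).2.1) (b := fun t => u * cos (f t).2.2)
      (c := fun t => ε * cos (2 * (f t).2.2)) (by fun_prop) (by fun_prop)
      (fun t => (h₂ t).congr_deriv (by ring)) h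
  · exact sin_eq_zero_of_hasDerivAt (x := fun t => (f t).2.2) (b := fun t => u * cos (f t).1)
      (c := fun t => ε * cos (2 * (f t).1) + q * (1 - cos (f t).1)) (by fun_prop) (by fun_prop)
      (fun t => (h₃ t).congr_deriv (by ring)) h
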